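/- For every m ≥ 1, the number of arcs of the transfer digraph D*_m (ordered pairs (p,q) of binary words of length m with an arc p → q in D*_m) satisfies 2 · |E(D*_m)| = 3^m + (−1)^m. -/

import Mathlib

/-- The six alpha-letters, recording which two of the four directions are used
at a grid vertex by a 2-factor: `a` = down&right, `b` = up&down, `c` = up&right,
`d` = down&left, `e` = left&right, `f` = up&left. -/
inductive Alpha : Type
  | a | b | c | d | e | f
  deriving DecidableEq

/-- The letter has a right edge iff it lies in `{a, c, e}`. -/
def Alpha.right : Alpha → Bool
  | .a => true
  | .c => true
  | .e => true
  | _ => false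

/-- The letter has a left edge iff it lies in `{d, e, f}`. -/
def Alpha.left : Alpha → Bool
  | .d => true
  | .e => true
  | .f => true
  | _ => false

/-- The letter has a down edge iff it lies in `{a, b, d}`. -/
def Alpha.down : Alpha → Bool
  | .a => true
  | .b => true
  | .d => true
  | _ => false

/-- The letter has an up edge iff it lies in `{b, c, f}`. -/
def Alpha.up : Alpha → Bool
  | .b => true
  | .c => true
  | .f => true
  | _ => false

/-- Membership in the vertex set `V(D_m)` of the digraph `D_m`: consecutive letters are
compatible (`w i` has a down edge iff `w (i+1)` has an up edge), the first letter has no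
up edge, and the last letter has no down edge. -/
def InVD {m : ℕ} (w : Fin m → Alpha) : Prop :=
  (∀ i j : Fin m, (j : ℕ) = (i : ℕ) + 1 → (w i).down = (w j).up) ∧
  (∀ i : Fin m, (i : ℕ) = 0 → (w i).up = false) ∧
  (∀ i : Fin m, (i : ℕ) = m - 1 → (w i).down = false)

/-- The arc relation of the digraph `D_m`: `v → u` iff both are vertices of `D_m` and for
every `i`, `v i` has a right edge iff `u i` has a left edge. -/
def DArc {m : ℕ} (v u : Fin m → Alpha) : Prop :=
  InVD v ∧ InVD u ∧ ∀ i, (v i).right = (u i).left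

/-- The outlet word of an alpha-word: `o(w) i = true` iff `w i` has a right edge. -/
def outlet {m : ℕ} (w : Fin m → Alpha) : Fin m → Bool :=
  fun i => (w i).right

/-- Membership in the vertex set `V(D*_m)` of the transfer digraph `D*_m`: the binary
words realized as outlet words of vertices of `D_m`. -/
def InVDStar {m : ℕ} (p : Fin m → Bool) : Prop :=
  ∃ w : Fin m → Alpha, InVD w ∧ outlet w = p

/-- The arc relation of the transfer digraph `D*_m`: `p → q` iff there are vertices
`v, u` of `D_m` with outlet words `p, q` and an arc `v → u` in `D_m`. -/
def DStarArc {m : ℕ} (p q : Fin m → Bool) : Prop :=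
  ∃ v u : Fin m → Alpha, outlet v = p ∧ outlet u = q ∧ DArc v u

instance Alpha.instFintype : Fintype Alpha :=
  ⟨{.a, .b, .c, .d, .e, .f}, fun x => by cases x <;> decide⟩

theorem Alpha.sum_univ {M : Type*} [AddCommMonoid M] (g : Alpha → M) :
    ∑ x, g x = g .a + (g .b + (g .c + (g .d + (g .e + g .f)))) := by
  change ∑ x ∈ ({.a, .b, .c, .d, .e, .f} : Finset Alpha), g x = _
  simp

/-- Reflection in a vertical axis: exchanges the left and right edges. -/
def Alpha.mirror : Alpha → Alpha
  | .a => .d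
  | .b => .b
  | .c => .f
  | .d => .a
  | .e => .e
  | .f => .c

theorem Alpha.right_mirror (x : Alpha) : x.mirror.right = x.left := by cases x <;> rfl

theorem Alpha.up_mirror (x : Alpha) : x.mirror.up = x.up := by cases x <;> rfl

theorem Alpha.down_mirror (x : Alpha) : x.mirror.down = x.down := by cases x <;> rfl

theorem Alpha.ext_up_left_right {x y : Alpha} (hu : x.up = y.up) (hl : x.left = y.left)
    (hr : x.right = y.right) : x = y := by
  revert hu hl hr
  cases x <;> cases y <;> decide

theorem InVD.mirror {m : ℕ} {w : Fin m → Alpha} (h : InVD w) :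
    InVD fun i => (w i).mirror := by
  simpa only [InVD, Alpha.up_mirror, Alpha.down_mirror] using h

theorem dStarArc_iff {m : ℕ} {p q : Fin m → Bool} :
    DStarArc p q ↔ ∃ u, InVD u ∧ (fun i => (u i).left) = p ∧ outlet u = q := by
  constructor
  · rintro ⟨v, u, rfl, rfl, -, hu, h⟩
    exact ⟨u, hu, funext fun i => (h i).symm, rfl⟩
  · rintro ⟨u, hu, rfl, rfl⟩
    exact ⟨fun i => (u i).mirror, u, funext fun i => (u i).right_mirror, rfl, hu.mirror, hu,
      fun i => (u i).right_mirror⟩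

/-- Vertices of `D_m` are determined by their left and right edges. -/
theorem InVD.eq_of_left_right {m : ℕ} {w z : Fin m → Alpha} (hw : InVD w) (hz : InVD z)
    (hl : ∀ i, (w i).left = (z i).left) (hr : ∀ i, (w i).right = (z i).right) : w = z := by
  have key : ∀ (k : ℕ) (hk : k < m), w ⟨k, hk⟩ = z ⟨k, hk⟩ := by
    intro k
    induction k with
    | zero =>
      intro hk
      exact Alpha.ext_up_left_right ((hw.2.1 _ rfl).trans (hz.2.1 _ rfl).symm) (hl _) (hr _)
    | succ k ih =>
      intro hk
      refine Alpha.ext_up_left_right ?_ (hl _) (hr _)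
      rw [← hw.1 ⟨k, by omega⟩ ⟨k + 1, hk⟩ rfl, ← hz.1 ⟨k, by omega⟩ ⟨k + 1, hk⟩ rfl, ih]
  exact funext fun i => key i i.2

theorem card_dStarArc (m : ℕ) :
    Nat.card {pq : (Fin m → Bool) × (Fin m → Bool) // DStarArc pq.1 pq.2} =
      Nat.card {w : Fin m → Alpha // InVD w} := by
  symm
  refine Nat.card_eq_of_bijective
    (fun w => ⟨(fun i => (w.1 i).left, outlet w.1), dStarArc_iff.2 ⟨w.1, w.2, rfl, rfl⟩⟩) ⟨?_, ?_⟩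
  · intro w z h
    have h' := congrArg Subtype.val h
    exact Subtype.ext (w.2.eq_of_left_right z.2 (congrFun (congrArg Prod.fst h'))
      (congrFun (congrArg Prod.snd h')))
  · rintro ⟨⟨p, q⟩, h⟩
    obtain ⟨u, hu, rfl, rfl⟩ := dStarArc_iff.1 h
    exact ⟨⟨u, hu⟩, rfl⟩

/-- The column `w` can be traversed downwards, entering it with vertical edge state `s` and
leaving it without a vertical edge. -/
def ColumnFrom (s : Bool) : {m : ℕ} → (Fin m → Alpha) → Prop
  | 0, _ => s = false
  | _ + 1, w => (w 0).up = s ∧ ColumnFrom (w 0).down (Fin.tail w)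

theorem columnFrom_succ_iff {m : ℕ} {s : Bool} {w : Fin (m + 1) → Alpha} :
    ColumnFrom s w ↔ (∀ i : Fin m, (w i.castSucc).down = (w i.succ).up) ∧
      (w 0).up = s ∧ (w (Fin.last m)).down = false := by
  induction m generalizing s with
  | zero => simp [ColumnFrom]
  | succ m ih =>
    rw [ColumnFrom, ih, Fin.forall_fin_succ]
    simp only [Fin.tail, Fin.succ_last, Fin.castSucc_zero, Fin.succ_castSucc]
    tauto

theorem inVD_iff_columnFrom {m : ℕ} {w : Fin m → Alpha} : InVD w ↔ ColumnFrom false w := by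
  cases m with
  | zero => simp [InVD, ColumnFrom]
  | succ m =>
    rw [columnFrom_succ_iff]
    refine and_congr ⟨fun h i => h _ _ (by simp), fun h i j hij => ?_⟩
      (and_congr ⟨fun h => h 0 rfl, fun h i hi => ?_⟩
        ⟨fun h => h (Fin.last m) (by simp), fun h i hi => ?_⟩)
    · have hi : (i : ℕ) < m := by omega
      have hj : j = Fin.succ ⟨i, hi⟩ := Fin.ext hij
      rw [hj]
      exact h ⟨i, hi⟩
    · rwa [show i = 0 from Fin.ext hi]
    · rwa [show i = Fin.last m from Fin.ext (by simpa using hi)]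

/-- Splitting off the top letter of a column. -/
def columnFromSuccEquiv (m : ℕ) (s : Bool) :
    {w : Fin (m + 1) → Alpha // ColumnFrom s w} ≃
      Σ x : Alpha, {w : Fin m → Alpha // x.up = s ∧ ColumnFrom x.down w} where
  toFun w := ⟨w.1 0, Fin.tail w.1, w.2⟩
  invFun y := ⟨Fin.cons y.1 y.2.1, y.2.2⟩
  left_inv w := Subtype.ext (Fin.cons_self_tail w.1)
  right_inv _ := rfl

theorem card_columnFrom_succ (m : ℕ) (s : Bool) :
    Nat.card {w : Fin (m + 1) → Alpha // ColumnFrom s w} =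
      Nat.card {w : Fin m → Alpha // ColumnFrom s w} +
        2 * Nat.card {w : Fin m → Alpha // ColumnFrom (!s) w} := by
  rw [Nat.card_congr (columnFromSuccEquiv m s), Nat.card_sigma, Alpha.sum_univ]
  cases s <;> simp [Alpha.up, Alpha.down] <;> ring

theorem two_mul_card_columnFrom (m : ℕ) :
    (2 : ℤ) * Nat.card {w : Fin m → Alpha // ColumnFrom false w} = 3 ^ m + (-1) ^ m ∧
      (2 : ℤ) * Nat.card {w : Fin m → Alpha // ColumnFrom true w} = 3 ^ m - (-1) ^ m := by
  induction m with
  | zero => simp [ColumnFrom]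
  | succ m ih =>
    obtain ⟨h₀, h₁⟩ := ih
    rw [card_columnFrom_succ, card_columnFrom_succ, Bool.not_false, Bool.not_true]
    push_cast
    constructor
    · linear_combination h₀ + 2 * h₁
    · linear_combination h₁ + 2 * h₀

/-- The number of arcs of the transfer digraph `D*_m` satisfies
`2 ⬝ |E(D*_m)| = 3^m + (-1)^m`. -/
theorem card_EDStar (m : ℕ) (hm : 1 ≤ m) :
    (2 : ℤ) * Nat.card {pq : (Fin m → Bool) × (Fin m → Bool) // DStarArc pq.1 pq.2} =
      3 ^ m + (-1) ^ m := by
  rw [card_dStarArc, Nat.card_congr (Equiv.subtypeEquivRight fun _ => inVD_iff_columnFrom)]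
  exact (two_mul_card_columnFrom m).1
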